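/- Let ψ : (0,∞) → ℝ be a smooth, real-valued, rapidly decaying fiducial vector with unit L² norm. Then for every q > 0 and p ∈ ℝ the iterated integral (1/(2π c₋₁(ψ))) ∫₀^∞ ( ∫_ℝ (p′)² |⟨U(q,p)ψ, U(q′,p′)ψ⟩|² dp′ ) dq′ converges and equals p² + c(ψ)/q², where c(ψ) = ∫₀^∞ (ψ′(x))² (1 + (c₀(ψ)/c₋₁(ψ)) x) dx. (The lower symbol of p² is p² + c(ψ)/q², exhibiting the repulsive centrifugal correction.) -/

import Mathlib

open MeasureTheory Set Filter

/-- The affine group representation `(U(q,p)ψ)(x) = e^{ipx} q^{-1/2} ψ(x/q)`. -/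
noncomputable def Uop (q p : ℝ) (ψ : ℝ → ℂ) : ℝ → ℂ :=
  fun x => Complex.exp (Complex.I * (p : ℂ) * (x : ℂ)) * ((Real.sqrt q : ℝ) : ℂ)⁻¹ * ψ (x / q)

/-- Inner product `⟨f,g⟩ = ∫₀^∞ conj(f x) g x dx`, conjugate-linear in the first argument. -/
noncomputable def hinner (f g : ℝ → ℂ) : ℂ :=
  ∫ x in Set.Ioi (0:ℝ), (starRingEnd ℂ) (f x) * g x

/-- The constant `c_γ(ψ) = ∫₀^∞ ψ(x)² x^{-(γ+2)} dx` for a real fiducial vector. -/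
noncomputable def cgamR (γ : ℝ) (ψ : ℝ → ℝ) : ℝ :=
  ∫ x in Set.Ioi (0:ℝ), (ψ x) ^ 2 * x ^ (-(γ + 2))

/-- A smooth real fiducial vector all of whose derivatives decay faster than any power
of `x` as `x → 0⁺` and as `x → ∞`. -/
def RapidlyDecaying (ψ : ℝ → ℝ) : Prop :=
  ContDiff ℝ (⊤ : ℕ∞) ψ ∧ ∀ N k : ℕ,
    Filter.Tendsto (fun x => iteratedDeriv k ψ x / x ^ N)
      (nhdsWithin 0 (Set.Ioi (0:ℝ))) (nhds 0) ∧
    Filter.Tendsto (fun x => x ^ N * iteratedDeriv k ψ x) Filter.atTop (nhds 0)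

open scoped SchwartzMap FourierTransform

theorem RapidlyDecaying.iteratedDeriv_zero {ψ : ℝ → ℝ} (hψ : RapidlyDecaying ψ) (k : ℕ) :
    iteratedDeriv k ψ 0 = 0 := by
  have h := (hψ.2 0 k).1
  simp only [pow_zero, div_one] at h
  have hc : Continuous (iteratedDeriv k ψ) :=
    hψ.1.continuous_iteratedDeriv k (by exact_mod_cast le_top)
  exact tendsto_nhds_unique (hc.continuousAt.tendsto.mono_left nhdsWithin_le_nhds) h

theorem RapidlyDecaying.hasDerivAt_indicator {ψ : ℝ → ℝ} (hψ : RapidlyDecaying ψ) (k : ℕ) (x : ℝ) :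
    HasDerivAt ((Ioi 0).indicator (iteratedDeriv k ψ))
      ((Ioi 0).indicator (iteratedDeriv (k + 1) ψ) x) x := by
  have hd (y : ℝ) : HasDerivAt (iteratedDeriv k ψ) (iteratedDeriv (k + 1) ψ y) y := by
    rw [iteratedDeriv_succ]
    exact (hψ.1.differentiable_iteratedDeriv k
      (by exact_mod_cast WithTop.coe_lt_top k)).differentiableAt.hasDerivAt
  rcases lt_trichotomy x 0 with hx | rfl | hx
  · rw [indicator_of_notMem (by simpa using hx.le)]
    refine (hasDerivAt_const x (0 : ℝ)).congr_of_eventuallyEq ?_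
    filter_upwards [Iio_mem_nhds hx] with y hy
    exact indicator_of_notMem (by simpa using le_of_lt hy) _
  · rw [indicator_of_notMem (by simp), ← hasDerivWithinAt_univ, ← Iic_union_Ici (a := (0 : ℝ))]
    refine HasDerivWithinAt.union ?_ ?_
    · refine (hasDerivWithinAt_const (0 : ℝ) (Iic 0) (0 : ℝ)).congr (fun y hy => ?_)
        (indicator_of_notMem (by simp) _)
      exact indicator_of_notMem (by simpa using hy) _
    · have h0 := hd 0
      rw [hψ.iteratedDeriv_zero] at h0
      refine h0.hasDerivWithinAt.congr (fun y hy => ?_) (by simp [hψ.iteratedDeriv_zero])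
      rcases eq_or_lt_of_le (show (0 : ℝ) ≤ y from hy) with rfl | hy
      · simp [hψ.iteratedDeriv_zero]
      · exact indicator_of_mem hy _
  · rw [indicator_of_mem (by simpa using hx)]
    refine (hd x).congr_of_eventuallyEq ?_
    filter_upwards [Ioi_mem_nhds hx] with y hy
    exact indicator_of_mem hy _

theorem RapidlyDecaying.iteratedDeriv_indicator {ψ : ℝ → ℝ} (hψ : RapidlyDecaying ψ) (k : ℕ) :
    iteratedDeriv k ((Ioi 0).indicator ψ) = (Ioi 0).indicator (iteratedDeriv k ψ) := by
  induction k with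
  | zero => simp
  | succ k ih =>
    rw [iteratedDeriv_succ, ih]
    exact funext fun x => (hψ.hasDerivAt_indicator k x).deriv

theorem RapidlyDecaying.exists_schwartzMap {ψ : ℝ → ℝ} (hψ : RapidlyDecaying ψ) :
    ∃ g : 𝓢(ℝ, ℝ), ⇑g = (Ioi 0).indicator ψ := by
  refine ⟨⟨(Ioi 0).indicator ψ, ?_, fun N k => ?_⟩, rfl⟩
  · refine contDiff_of_differentiable_iteratedDeriv fun k _ => ?_
    rw [hψ.iteratedDeriv_indicator]
    exact fun x => (hψ.hasDerivAt_indicator k x).differentiableAt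
  · have hc : Continuous (iteratedDeriv k ψ) :=
      hψ.1.continuous_iteratedDeriv k (by exact_mod_cast le_top)
    obtain ⟨R, hR⟩ := Metric.tendsto_atTop.1 (hψ.2 N k).2 1 one_pos
    obtain ⟨C, hC⟩ := (isCompact_Icc (a := (0 : ℝ)) (b := R)).exists_bound_of_continuousOn
      (f := fun x => x ^ N * iteratedDeriv k ψ x) (by fun_prop)
    refine ⟨max C 1, fun x => ?_⟩
    rw [norm_iteratedFDeriv_eq_norm_iteratedDeriv, hψ.iteratedDeriv_indicator, ← norm_pow,
      ← norm_mul]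
    by_cases hx : 0 < x
    · rw [indicator_of_mem (by simpa using hx)]
      rcases le_total x R with h | h
      · exact (hC x ⟨hx.le, h⟩).trans (le_max_left _ _)
      · have := hR x h
        rw [dist_zero_right] at this
        exact this.le.trans (le_max_right _ _)
    · rw [indicator_of_notMem (by simpa using hx)]
      simp

theorem SchwartzMap.integral_sq_mul_norm_fourier_sq (f : 𝓢(ℝ, ℝ)) (p : ℝ) :
    Integrable (fun s : ℝ =>
        s ^ 2 * ‖∫ x : ℝ, Complex.exp (Complex.I * ((s - p : ℝ) : ℂ) * x) * (f x : ℂ)‖ ^ 2) ∧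
      ∫ s : ℝ, s ^ 2 * ‖∫ x : ℝ, Complex.exp (Complex.I * ((s - p : ℝ) : ℂ) * x) * (f x : ℂ)‖ ^ 2 =
        2 * Real.pi * ∫ x : ℝ, ((deriv f x) ^ 2 + p ^ 2 * (f x) ^ 2) := by
  set F : 𝓢(ℝ, ℂ) := f.postcompCLM Complex.ofRealCLM with hF
  set K : 𝓢(ℝ, ℂ) := derivCLM ℂ ℂ F + (-(Complex.I * p)) • F with hK
  have hFd (x : ℝ) : deriv F x = ((deriv f x : ℝ) : ℂ) := ((f.hasDerivAt x).ofReal_comp).deriv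
  have hKx (x : ℝ) : ‖K x‖ ^ 2 = (deriv f x) ^ 2 + p ^ 2 * (f x) ^ 2 := by
    have : K x = ((deriv f x : ℝ) : ℂ) + ((-(p * f x) : ℝ) : ℂ) * Complex.I := by
      simp only [hK, add_apply, smul_apply, derivCLM_apply, hFd, smul_eq_mul]
      simp [hF]
      ring
    rw [this, Complex.sq_norm, Complex.normSq_add_mul_I]
    ring
  have hKF (ξ : ℝ) : 𝓕 K ξ = (2 * Real.pi * ξ - p) * Complex.I * 𝓕 F ξ := by
    have h1 : 𝓕 (derivCLM ℂ ℂ F) ξ = (2 * Real.pi * Complex.I * ξ) • 𝓕 F ξ := by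
      have := congrFun (Real.fourier_deriv F.integrable F.differentiable
        (derivCLM ℂ ℂ F).integrable) ξ
      exact this
    rw [hK, FourierTransform.fourier_add, FourierTransform.fourier_smul, add_apply, smul_apply, h1]
    simp only [smul_eq_mul]
    ring
  have key (s : ℝ) :
      s ^ 2 * ‖∫ x : ℝ, Complex.exp (Complex.I * ((s - p : ℝ) : ℂ) * x) * (f x : ℂ)‖ ^ 2 =
        ‖𝓕 K ((s - p) * (-(2 * Real.pi)⁻¹))‖ ^ 2 := by
    have hpi := Real.pi_ne_zero
    have h1 : 𝓕 F ((s - p) * (-(2 * Real.pi)⁻¹)) =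
        ∫ x : ℝ, Complex.exp (Complex.I * ((s - p : ℝ) : ℂ) * x) * (f x : ℂ) := by
      rw [fourier_coe, Real.fourier_real_eq_integral_exp_smul]
      refine integral_congr_ae (.of_forall fun x => ?_)
      simp only [smul_eq_mul]
      congr 2
      push_cast
      field_simp
    have h2 : 2 * Real.pi * ((((s - p) * (-(2 * Real.pi)⁻¹) : ℝ)) : ℂ) - p = ((-s : ℝ) : ℂ) := by
      push_cast
      field_simp
      ring
    rw [hKF, h1, h2, norm_mul, norm_mul, Complex.norm_I, Complex.norm_real, Real.norm_eq_abs,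
      mul_one, mul_pow, sq_abs, neg_sq]
  have hc : (-(2 * Real.pi)⁻¹) ≠ 0 := neg_ne_zero.2 (inv_ne_zero Real.two_pi_pos.ne')
  have hint : Integrable fun ξ => ‖𝓕 K ξ‖ ^ 2 := (memLp_two_iff_integrable_sq_norm
    (𝓕 K).continuous.aestronglyMeasurable).1 ((𝓕 K).memLp 2)
  simp only [key]
  refine ⟨(hint.comp_mul_right' hc).comp_sub_right p, ?_⟩
  rw [integral_sub_right_eq_self (fun s => ‖𝓕 K (s * (-(2 * Real.pi)⁻¹))‖ ^ 2) p,
    Measure.integral_comp_mul_right (fun s => ‖𝓕 K s‖ ^ 2), integral_norm_sq_fourier]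
  simp only [hKx, inv_neg, inv_inv, abs_neg, abs_of_pos Real.two_pi_pos, smul_eq_mul]

theorem integrableOn_comp_div_mul_zpow {b : ℝ → ℝ} {m : ℤ}
    (hb : IntegrableOn (fun u => b u * u ^ (m - 2)) (Ioi 0)) {x : ℝ} (hx : 0 < x) :
    IntegrableOn (fun q => b (x / q) * q ^ (-m)) (Ioi 0) ∧
      ∫ q in Ioi 0, b (x / q) * q ^ (-m) = x ^ (1 - m) * ∫ u in Ioi 0, b u * u ^ (m - 2) := by
  set G : ℝ → ℝ := fun u => b u * u ^ (m - 2) with hG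
  have key : ∀ q ∈ Ioi (0 : ℝ), b (x / q) * q ^ (-m) =
      x ^ (2 - m) * ((|(-1 : ℝ)| * q ^ ((-1 : ℝ) - 1)) • G (x * q ^ (-1 : ℝ))) := by
    intro q hq
    have hq : 0 < q := hq
    rw [hG, smul_eq_mul, Real.rpow_neg_one, show (-1 : ℝ) - 1 = ((-2 : ℤ) : ℝ) by norm_num,
      Real.rpow_intCast, abs_neg, abs_one, one_mul, ← div_eq_mul_inv]
    have h1 : (x / q) ^ (m - 2) = x ^ (m - 2) * q ^ (2 - m) := by
      rw [div_zpow, div_eq_mul_inv, ← zpow_neg, neg_sub]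
    have h2 : x ^ (2 - m) * x ^ (m - 2) = 1 := by
      rw [← zpow_add₀ hx.ne']; simp
    have h3 : q ^ (-2 : ℤ) * q ^ (2 - m) = q ^ (-m) := by
      rw [← zpow_add₀ hq.ne']; congr 1; ring
    simp only [h1, ← h3]
    linear_combination (-(b (x / q) * (q ^ (-2 : ℤ) * q ^ (2 - m)))) * h2
  have hGx : IntegrableOn (fun u => G (x * u)) (Ioi 0) := by
    rw [integrableOn_Ioi_comp_mul_left_iff _ _ hx, mul_zero]
    exact hb
  have hne : (-1 : ℝ) ≠ 0 := by norm_num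
  constructor
  · refine IntegrableOn.congr_fun ?_ (fun q hq => (key q hq).symm) measurableSet_Ioi
    exact ((integrableOn_Ioi_comp_rpow_iff (fun u => G (x * u)) hne).2 hGx).const_mul _
  · rw [setIntegral_congr_fun measurableSet_Ioi key, integral_const_mul,
      integral_comp_rpow_Ioi (fun u => G (x * u)) hne, integral_comp_mul_left_Ioi G 0 hx, mul_zero,
      smul_eq_mul, ← mul_assoc, ← zpow_sub_one₀ hx.ne']
    congr 2
    ring

theorem integrable_prod_mul_comp_div {a b : ℝ → ℝ} (ha : Measurable a) (hb : Measurable b) {m : ℤ}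
    (ha' : IntegrableOn (fun x => a x * x ^ (1 - m)) (Ioi 0))
    (hb' : IntegrableOn (fun u => b u * u ^ (m - 2)) (Ioi 0)) :
    Integrable (fun z : ℝ × ℝ => a z.2 * (b (z.2 / z.1) * z.1 ^ (-m)))
        ((volume.restrict (Ioi 0)).prod (volume.restrict (Ioi 0))) ∧
      ∫ z : ℝ × ℝ, a z.2 * (b (z.2 / z.1) * z.1 ^ (-m))
          ∂(volume.restrict (Ioi 0)).prod (volume.restrict (Ioi 0)) =
        (∫ x in Ioi 0, a x * x ^ (1 - m)) * ∫ u in Ioi 0, b u * u ^ (m - 2) := by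
  have hmeas : Measurable fun z : ℝ × ℝ => a z.2 * (b (z.2 / z.1) * z.1 ^ (-m)) := by
    fun_prop
  have hint : Integrable (fun z : ℝ × ℝ => a z.2 * (b (z.2 / z.1) * z.1 ^ (-m)))
      ((volume.restrict (Ioi 0)).prod (volume.restrict (Ioi 0))) := by
    refine (integrable_prod_iff' hmeas.aestronglyMeasurable).2 ⟨?_, ?_⟩
    · filter_upwards [ae_restrict_mem measurableSet_Ioi] with x hx
      exact (integrableOn_comp_div_mul_zpow hb' hx).1.const_mul _
    · have habs : IntegrableOn (fun u => |b u| * u ^ (m - 2)) (Ioi 0) := by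
        refine IntegrableOn.congr_fun (Integrable.abs hb') (fun u hu => ?_) measurableSet_Ioi
        have hu : 0 < u := hu
        simp only [abs_mul, abs_of_pos (zpow_pos hu _)]
      refine IntegrableOn.congr_fun
        (f := fun x => |a x * x ^ (1 - m)| * ∫ u in Ioi 0, |b u| * u ^ (m - 2))
        (ha'.abs.mul_const _) (fun x hx => ?_) measurableSet_Ioi
      have hx : 0 < x := hx
      simp only [Real.norm_eq_abs, abs_mul, integral_const_mul, abs_of_pos (zpow_pos hx _)]
      rw [mul_assoc, ← (integrableOn_comp_div_mul_zpow habs hx).2]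
      congr 1
      refine setIntegral_congr_fun measurableSet_Ioi fun q hq => ?_
      have hq : 0 < q := hq
      simp only [abs_of_pos (zpow_pos hq _)]
  refine ⟨hint, ?_⟩
  rw [integral_prod_symm _ hint, ← integral_mul_const]
  refine setIntegral_congr_fun measurableSet_Ioi fun x hx => ?_
  simp only [integral_const_mul]
  rw [(integrableOn_comp_div_mul_zpow hb' hx).2, mul_assoc]

theorem integrableOn_comp_div_mul_zpow_right {a : ℝ → ℝ} {n : ℤ} {q : ℝ} (hq : 0 < q)
    (ha : IntegrableOn (fun u => a u * u ^ n) (Ioi 0)) :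
    IntegrableOn (fun x => a (x / q) * x ^ n) (Ioi 0) ∧
      ∫ x in Ioi 0, a (x / q) * x ^ n = q ^ (n + 1) * ∫ u in Ioi 0, a u * u ^ n := by
  set G : ℝ → ℝ := fun u => a u * u ^ n with hG
  have key : (fun x => a (x / q) * x ^ n) = fun x => q ^ n * G (q⁻¹ * x) := by
    funext x
    have : q ^ n ≠ 0 := (zpow_pos hq n).ne'
    rw [hG]
    simp only [mul_zpow, inv_zpow, div_eq_inv_mul]
    field_simp
  have hq' : 0 < q⁻¹ := inv_pos.2 hq
  rw [key]
  constructor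
  · refine Integrable.const_mul (?_ : IntegrableOn (fun x => G (q⁻¹ * x)) (Ioi 0)) _
    rwa [integrableOn_Ioi_comp_mul_left_iff _ _ hq', mul_zero]
  · rw [integral_const_mul, integral_comp_mul_left_Ioi G 0 hq', mul_zero, inv_inv, smul_eq_mul,
      ← mul_assoc, zpow_add_one₀ hq.ne']

theorem SchwartzMap.integrable_mul (f g : 𝓢(ℝ, ℝ)) : Integrable fun x => f x * g x :=
  (f.memLp 2).integrable_mul (g.memLp 2)

theorem SchwartzMap.memLp_div_self_Ioi (g : 𝓢(ℝ, ℝ)) (hg : g 0 = 0) :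
    MemLp (fun x => g x / x) 2 (volume.restrict (Ioi 0)) := by
  have hmeas : Measurable fun x => g x / x := g.continuous.measurable.div measurable_id
  rw [memLp_two_iff_integrable_sq hmeas.aestronglyMeasurable]
  obtain ⟨C, hC0, hC⟩ := (derivCLM ℝ ℝ g).decay 0 0
  have hlip (x : ℝ) : |g x| ≤ C * |x| := by
    have := Convex.norm_image_sub_le_of_norm_deriv_le (f := g) (s := univ) (C := C)
      (fun y _ => g.differentiableAt) (fun y _ => by simpa using hC y) convex_univ
      (mem_univ 0) (mem_univ x)
    simpa [hg] using this
  rw [← Ioc_union_Ioi_eq_Ioi zero_le_one]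
  refine IntegrableOn.union ?_ ?_
  · refine Measure.integrableOn_of_bounded (M := C ^ 2) (by simp)
      (hmeas.pow_const 2).aestronglyMeasurable ?_
    filter_upwards [ae_restrict_mem measurableSet_Ioc] with x hx
    rw [norm_pow, Real.norm_eq_abs, abs_div]
    gcongr
    exact (div_le_iff₀ (abs_pos.2 hx.1.ne')).2 (hlip x)
  · refine Integrable.mono' (g.integrable_mul g).integrableOn
      (hmeas.pow_const 2).aestronglyMeasurable ?_
    filter_upwards [ae_restrict_mem measurableSet_Ioi] with x hx
    have hx : 1 < x := hx
    rw [norm_pow, Real.norm_eq_abs, sq_abs, div_pow, ← sq]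
    exact div_le_self (sq_nonneg _) (by nlinarith)

theorem SchwartzMap.integrableOn_sq_mul_zpow_neg_two (g : 𝓢(ℝ, ℝ)) (hg : g 0 = 0) :
    IntegrableOn (fun x => g x ^ 2 * x ^ (-2 : ℤ)) (Ioi 0) := by
  refine IntegrableOn.congr_fun (f := fun x => (g x / x) ^ 2)
    (g.memLp_div_self_Ioi hg).integrable_sq (fun x _ => ?_) measurableSet_Ioi
  beta_reduce
  rw [zpow_neg, div_pow, div_eq_mul_inv]
  norm_cast

theorem SchwartzMap.integrableOn_mul_mul_zpow_neg_one (g h : 𝓢(ℝ, ℝ)) (hg : g 0 = 0) :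
    IntegrableOn (fun x => g x * h x * x ^ (-1 : ℤ)) (Ioi 0) := by
  refine IntegrableOn.congr_fun (f := fun x => g x / x * h x)
    ((g.memLp_div_self_Ioi hg).integrable_mul ((h.memLp 2).restrict _)) (fun x _ => ?_)
    measurableSet_Ioi
  simp only [zpow_neg, zpow_one]
  ring

theorem SchwartzMap.integrableOn_sq_mul_self (h : 𝓢(ℝ, ℝ)) :
    IntegrableOn (fun x => h x ^ 2 * x) (Ioi 0) := by
  have := ((pairing (ContinuousLinearMap.mul ℝ ℝ) h h).integrable_pow_mul volume 1).integrableOn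
    (s := Ioi 0)
  refine IntegrableOn.congr_fun this (fun x hx => ?_) measurableSet_Ioi
  have hx : 0 < x := hx
  simp only [pairing_apply_apply, ContinuousLinearMap.mul_apply', pow_one, Real.norm_eq_abs,
    abs_of_pos hx, abs_mul_self]
  ring

theorem SchwartzMap.integral_mul_deriv_Ioi (g : 𝓢(ℝ, ℝ)) (hg : ∀ x ≤ 0, g x = 0) :
    ∫ x in Ioi 0, g x * deriv g x = 0 := by
  rw [setIntegral_eq_integral_of_forall_compl_eq_zero
    (fun x hx => by rw [hg x (by simpa using hx), zero_mul])]
  have := integral_mul_deriv_eq_neg_deriv_mul g g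
  simp only [mul_comm (deriv g _)] at this
  linarith

/-- The Schwartz function `x ↦ f (x / q)`. -/
noncomputable def SchwartzMap.dilate (f : 𝓢(ℝ, ℝ)) {q : ℝ} (hq : 0 < q) : 𝓢(ℝ, ℝ) :=
  compCLMOfContinuousLinearEquiv ℝ
    (ContinuousLinearEquiv.unitsEquivAut ℝ (Units.mk0 q⁻¹ (inv_ne_zero hq.ne'))) f

@[simp]
theorem SchwartzMap.dilate_apply (f : 𝓢(ℝ, ℝ)) {q : ℝ} (hq : 0 < q) (x : ℝ) :
    f.dilate hq x = f (x / q) := by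
  simp [dilate, div_eq_mul_inv]

/-- The Schwartz function `x ↦ q^{-1/2} r^{-1/2} g(x/q) g(x/r)`. -/
noncomputable def SchwartzMap.dilateMul (g : 𝓢(ℝ, ℝ)) {q r : ℝ} (hq : 0 < q) (hr : 0 < r) :
    𝓢(ℝ, ℝ) :=
  (√q * √r)⁻¹ • pairing (ContinuousLinearMap.mul ℝ ℝ) (g.dilate hq) (g.dilate hr)

@[simp]
theorem SchwartzMap.dilateMul_apply (g : 𝓢(ℝ, ℝ)) {q r : ℝ} (hq : 0 < q) (hr : 0 < r) (x : ℝ) :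
    g.dilateMul hq hr x = (√q * √r)⁻¹ * (g (x / q) * g (x / r)) := by
  simp [dilateMul]

theorem SchwartzMap.deriv_dilateMul (g : 𝓢(ℝ, ℝ)) {q r : ℝ} (hq : 0 < q) (hr : 0 < r) (x : ℝ) :
    deriv (g.dilateMul hq hr) x =
      (√q * √r)⁻¹ * (deriv g (x / q) / q * g (x / r) + g (x / q) * (deriv g (x / r) / r)) := by
  have hd (s : ℝ) : HasDerivAt (fun y => g (y / s)) (deriv g (x / s) / s) x := by
    rw [← mul_one_div]
    exact (g.hasDerivAt (x / s)).comp x ((hasDerivAt_id x).div_const s)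
  have := ((hd q).mul (hd r)).const_mul (√q * √r)⁻¹
  rw [← this.deriv]
  congr 1

theorem hinner_Uop_eq {ψ : ℝ → ℝ} {g : 𝓢(ℝ, ℝ)} (hg : ⇑g = (Ioi 0).indicator ψ)
    {q r : ℝ} (hq : 0 < q) (hr : 0 < r) (p s : ℝ) :
    hinner (Uop q p (fun x => (ψ x : ℂ))) (Uop r s (fun x => (ψ x : ℂ))) =
      ∫ x : ℝ, Complex.exp (Complex.I * ((s - p : ℝ) : ℂ) * x) * (g.dilateMul hq hr x : ℂ) := by
  rw [← setIntegral_eq_integral_of_forall_compl_eq_zero (s := Ioi 0)]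
  · refine setIntegral_congr_fun measurableSet_Ioi fun x hx => ?_
    have hx : 0 < x := hx
    have h1 : g (x / q) = ψ (x / q) := by rw [hg, indicator_of_mem (mem_Ioi.2 (div_pos hx hq))]
    have h2 : g (x / r) = ψ (x / r) := by rw [hg, indicator_of_mem (mem_Ioi.2 (div_pos hx hr))]
    have h3 : Complex.exp (Complex.I * ((s - p : ℝ) : ℂ) * x) =
        Complex.exp (-Complex.I * p * x) * Complex.exp (Complex.I * s * x) := by
      rw [← Complex.exp_add]
      congr 1
      push_cast
      ring
    simp only [Uop, SchwartzMap.dilateMul_apply, h1, h2, h3, map_mul, map_inv₀, Complex.conj_ofReal,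
      ← Complex.exp_conj, Complex.conj_I]
    push_cast
    rw [mul_inv]
    ring
  · intro x hx
    have : g (x / q) = 0 := by
      rw [hg, indicator_of_notMem]
      simpa using div_nonpos_of_nonpos_of_nonneg (by simpa using hx) hq.le
    simp [this]

/-- The value of `f'(x)² + p² f(x)²` for `f = g.dilateMul hq hr` and `0 < x`, expanded as a sum of
products of functions of `x` and of functions of `x / r` weighted by powers of `r`. -/
noncomputable def SchwartzMap.overlapDensity (g : 𝓢(ℝ, ℝ)) (p q r x : ℝ) : ℝ :=
  (q⁻¹ ^ 3 * deriv g (x / q) ^ 2 + p ^ 2 * q⁻¹ * g (x / q) ^ 2) * (g (x / r) ^ 2 * r ^ (-1 : ℤ)) +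
    (2 * q⁻¹ ^ 2 * (g (x / q) * deriv g (x / q))) * (g (x / r) * deriv g (x / r) * r ^ (-2 : ℤ)) +
    (q⁻¹ * g (x / q) ^ 2) * (deriv g (x / r) ^ 2 * r ^ (-3 : ℤ))

theorem SchwartzMap.integral_deriv_dilateMul_sq (g : 𝓢(ℝ, ℝ)) (hg : ∀ x ≤ 0, g x = 0) {q r : ℝ}
    (hq : 0 < q) (hr : 0 < r) (p : ℝ) :
    ∫ x : ℝ, ((deriv (g.dilateMul hq hr) x) ^ 2 + p ^ 2 * (g.dilateMul hq hr x) ^ 2) =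
      ∫ x in Ioi 0, g.overlapDensity p q r x := by
  rw [← setIntegral_eq_integral_of_forall_compl_eq_zero (s := Ioi 0)]
  · refine setIntegral_congr_fun measurableSet_Ioi fun x _ => ?_
    simp only [overlapDensity, deriv_dilateMul, dilateMul_apply, mul_pow, inv_pow, Real.sq_sqrt hq.le,
      Real.sq_sqrt hr.le, show (-3 : ℤ) = -((3 : ℕ) : ℤ) by rfl,
      show (-2 : ℤ) = -((2 : ℕ) : ℤ) by rfl, show (-1 : ℤ) = -((1 : ℕ) : ℤ) by rfl, zpow_neg,
      zpow_natCast]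
    field_simp
    ring
  · intro x hx
    have hx : x ≤ 0 := by simpa using hx
    simp [deriv_dilateMul, hg _ (div_nonpos_of_nonpos_of_nonneg hx hq.le),
      hg _ (div_nonpos_of_nonpos_of_nonneg hx hr.le)]

theorem SchwartzMap.integral_integral_dilateMul (g : 𝓢(ℝ, ℝ)) (hg : ∀ x ≤ 0, g x = 0) {q : ℝ}
    (hq : 0 < q) (p : ℝ) :
    IntegrableOn (fun r => ∫ x in Ioi 0, g.overlapDensity p q r x) (Ioi 0) ∧
    ∫ r in Ioi 0, ∫ x in Ioi 0, g.overlapDensity p q r x =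
      ((∫ x in Ioi 0, deriv g x ^ 2) / q ^ 2 + p ^ 2 * ∫ x in Ioi 0, g x ^ 2) *
          (∫ x in Ioi 0, g x ^ 2 * x ^ (-1 : ℤ)) +
        (∫ x in Ioi 0, g x ^ 2 * x ^ (-2 : ℤ)) / q ^ 2 * ∫ x in Ioi 0, deriv g x ^ 2 * x := by
  have hg0 : g 0 = 0 := hg 0 le_rfl
  have hgm : Measurable g := g.continuous.measurable
  have hdm : Measurable (deriv g) := measurable_deriv g
  have hgg : IntegrableOn (fun x => g x ^ 2 * x ^ (0 : ℤ)) (Ioi 0) := by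
    simpa [sq] using (g.integrable_mul g).integrableOn
  have hdd : IntegrableOn (fun x => deriv g x ^ 2 * x ^ (0 : ℤ)) (Ioi 0) := by
    simpa [sq] using ((derivCLM ℝ ℝ g).integrable_mul (derivCLM ℝ ℝ g)).integrableOn
  have hgd : IntegrableOn (fun x => g x * deriv g x * x ^ (0 : ℤ)) (Ioi 0) := by
    simpa using (g.integrable_mul (derivCLM ℝ ℝ g)).integrableOn
  have hgg1 : IntegrableOn (fun x => g x ^ 2 * x ^ (-1 : ℤ)) (Ioi 0) := by
    simpa [sq] using g.integrableOn_mul_mul_zpow_neg_one g hg0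
  have hgd1 : IntegrableOn (fun x => g x * deriv g x * x ^ (-1 : ℤ)) (Ioi 0) := by
    simpa using g.integrableOn_mul_mul_zpow_neg_one (derivCLM ℝ ℝ g) hg0
  have hgg2 := g.integrableOn_sq_mul_zpow_neg_two hg0
  have hddx : IntegrableOn (fun x => deriv g x ^ 2 * x ^ (1 : ℤ)) (Ioi 0) := by
    simpa using (derivCLM ℝ ℝ g).integrableOn_sq_mul_self
  have sgg := integrableOn_comp_div_mul_zpow_right hq hgg
  have sdd := integrableOn_comp_div_mul_zpow_right hq hdd
  have sgd1 := integrableOn_comp_div_mul_zpow_right (a := fun x => g x * deriv g x) hq hgd1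
  have sgg2 := integrableOn_comp_div_mul_zpow_right (a := fun x => g x ^ 2) hq hgg2
  have e1 : (fun x => (q⁻¹ ^ 3 * deriv g (x / q) ^ 2 + p ^ 2 * q⁻¹ * g (x / q) ^ 2) *
      x ^ (1 - 1 : ℤ)) = fun x => q⁻¹ ^ 3 * (deriv g (x / q) ^ 2 * x ^ (0 : ℤ)) +
        p ^ 2 * q⁻¹ * (g (x / q) ^ 2 * x ^ (0 : ℤ)) := by
    funext x
    rw [sub_self]
    ring
  have e2 : (fun x => (2 * q⁻¹ ^ 2 * (g (x / q) * deriv g (x / q))) * x ^ (1 - 2 : ℤ)) =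
      fun x => 2 * q⁻¹ ^ 2 * (g (x / q) * deriv g (x / q) * x ^ (-1 : ℤ)) := by
    funext x
    norm_num
    ring
  have e3 : (fun x => (q⁻¹ * g (x / q) ^ 2) * x ^ (1 - 3 : ℤ)) =
      fun x => q⁻¹ * (g (x / q) ^ 2 * x ^ (-2 : ℤ)) := by
    funext x
    norm_num
    ring
  obtain ⟨i1, v1⟩ := integrable_prod_mul_comp_div
    (a := fun x => q⁻¹ ^ 3 * deriv g (x / q) ^ 2 + p ^ 2 * q⁻¹ * g (x / q) ^ 2)
    (b := fun x => g x ^ 2) (m := 1) (by fun_prop) (by fun_prop)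
    (by rw [e1]; exact (sdd.1.const_mul _).add (sgg.1.const_mul _)) hgg1
  obtain ⟨i2, v2⟩ := integrable_prod_mul_comp_div
    (a := fun x => 2 * q⁻¹ ^ 2 * (g (x / q) * deriv g (x / q)))
    (b := fun x => g x * deriv g x) (m := 2) (by fun_prop) (by fun_prop)
    (by rw [e2]; exact sgd1.1.const_mul _) hgd
  obtain ⟨i3, v3⟩ := integrable_prod_mul_comp_div
    (a := fun x => q⁻¹ * g (x / q) ^ 2)
    (b := fun x => deriv g x ^ 2) (m := 3) (by fun_prop) (by fun_prop)
    (by rw [e3]; exact sgg2.1.const_mul _) hddx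
  have i12 := i1.add i2
  have i123 := i12.add i3
  refine ⟨i123.integral_prod_left, ?_⟩
  have hJ := integral_prod _ i123
  rw [integral_add' i12 i3, integral_add' i1 i2, v1, v2, v3] at hJ
  refine hJ.symm.trans ?_
  have hzero : ∫ u in Ioi 0, g u * deriv g u * u ^ (2 - 2 : ℤ) = 0 := by
    simpa using g.integral_mul_deriv_Ioi hg
  rw [hzero, e1, e3, integral_add (sdd.1.const_mul _) (sgg.1.const_mul _)]
  simp only [integral_const_mul]
  rw [sdd.2, sgg.2, sgg2.2]
  norm_num
  field_simp

theorem SchwartzMap.integral_sq_mul_zpow_neg_one_ne_zero (g : 𝓢(ℝ, ℝ)) (hg : g 0 = 0)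
    (hnorm : ∫ x in Ioi 0, g x ^ 2 = 1) : ∫ x in Ioi 0, g x ^ 2 * x ^ (-1 : ℤ) ≠ 0 := by
  intro h
  have hi : IntegrableOn (fun x => g x ^ 2 * x ^ (-1 : ℤ)) (Ioi 0) := by
    simpa [sq] using g.integrableOn_mul_mul_zpow_neg_one g hg
  have hnn : 0 ≤ᵐ[volume.restrict (Ioi 0)] fun x => g x ^ 2 * x ^ (-1 : ℤ) := by
    filter_upwards [ae_restrict_mem measurableSet_Ioi] with x hx
    have hx : 0 < x := hx
    simp only [Pi.zero_apply]
    positivity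
  have h0 := (setIntegral_eq_zero_iff_of_nonneg_ae hnn hi).1 h
  have : ∫ x in Ioi 0, g x ^ 2 = 0 := by
    refine integral_eq_zero_of_ae ?_
    filter_upwards [h0, ae_restrict_mem measurableSet_Ioi] with x hx hx0
    have hx0 : 0 < x := hx0
    simpa [hx0.ne'] using hx
  linarith

/-- The lower symbol of `p²` is `p² + c(ψ)/q²` with
`c(ψ) = ∫₀^∞ (ψ′(x))² (1 + (c₀/c₋₁) x) dx` (repulsive centrifugal correction). -/
theorem lower_symbol_of_p_sq (ψ : ℝ → ℝ)
    (hψ : RapidlyDecaying ψ)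
    (hnorm : ∫ x in Set.Ioi (0:ℝ), (ψ x) ^ 2 = 1)
    (q p : ℝ) (hq : 0 < q) :
    (∀ q' ∈ Set.Ioi (0:ℝ), Integrable (fun p' : ℝ =>
        p' ^ 2 * ‖hinner (Uop q p (fun x => (ψ x : ℂ)))
          (Uop q' p' (fun x => (ψ x : ℂ)))‖ ^ 2)) ∧
    IntegrableOn (fun q' : ℝ => ∫ p' : ℝ,
        p' ^ 2 * ‖hinner (Uop q p (fun x => (ψ x : ℂ)))
          (Uop q' p' (fun x => (ψ x : ℂ)))‖ ^ 2) (Set.Ioi (0:ℝ)) ∧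
    (1 / (2 * Real.pi * cgamR (-1) ψ)) * (∫ q' in Set.Ioi (0:ℝ), ∫ p' : ℝ,
        p' ^ 2 * ‖hinner (Uop q p (fun x => (ψ x : ℂ)))
          (Uop q' p' (fun x => (ψ x : ℂ)))‖ ^ 2) =
      p ^ 2 + (∫ x in Set.Ioi (0:ℝ),
          (deriv ψ x) ^ 2 * (1 + (cgamR 0 ψ / cgamR (-1) ψ) * x)) / q ^ 2 := by
  obtain ⟨g, hg⟩ := hψ.exists_schwartzMap
  have hgψ : ∀ x ∈ Ioi (0 : ℝ), ψ x = g x := fun x hx => by rw [hg, indicator_of_mem hx]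
  have hdψ : ∀ x ∈ Ioi (0 : ℝ), deriv ψ x = deriv g x := fun x hx =>
    Filter.EventuallyEq.deriv_eq (by filter_upwards [Ioi_mem_nhds hx] with y hy using hgψ y hy)
  have hg0 : ∀ x ≤ 0, g x = 0 := fun x hx => by
    rw [hg, indicator_of_notMem (by simpa using hx)]
  have hgn : ∫ x in Ioi 0, g x ^ 2 = 1 := by
    rw [← hnorm]
    exact setIntegral_congr_fun measurableSet_Ioi fun x hx => by simp only [hgψ x hx]
  have hc1 : cgamR (-1) ψ = ∫ x in Ioi 0, g x ^ 2 * x ^ (-1 : ℤ) :=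
    setIntegral_congr_fun measurableSet_Ioi fun x hx => by
      simp only [hgψ x hx, ← Real.rpow_intCast]
      norm_num
  have hc0 : cgamR 0 ψ = ∫ x in Ioi 0, g x ^ 2 * x ^ (-2 : ℤ) :=
    setIntegral_congr_fun measurableSet_Ioi fun x hx => by
      simp only [hgψ x hx, ← Real.rpow_intCast]
      norm_num
  have hc1ne := g.integral_sq_mul_zpow_neg_one_ne_zero (hg0 0 le_rfl) hgn
  obtain ⟨hJi, hJ⟩ := g.integral_integral_dilateMul hg0 hq p
  have hval : ∀ k : ℝ, ∫ x in Ioi 0, deriv ψ x ^ 2 * (1 + k * x) =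
      (∫ x in Ioi 0, deriv g x ^ 2) + k * ∫ x in Ioi 0, deriv g x ^ 2 * x := fun k => by
    have h1 : IntegrableOn (fun x => deriv g x ^ 2) (Ioi 0) := by
      simpa [sq] using ((SchwartzMap.derivCLM ℝ ℝ g).integrable_mul
        (SchwartzMap.derivCLM ℝ ℝ g)).integrableOn
    have h2 : IntegrableOn (fun x => deriv g x ^ 2 * x) (Ioi 0) := by
      simpa using (SchwartzMap.derivCLM ℝ ℝ g).integrableOn_sq_mul_self
    rw [← integral_const_mul, ← integral_add h1 (h2.const_mul k)]
    refine setIntegral_congr_fun measurableSet_Ioi fun x hx => ?_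
    simp only [hdψ x hx]
    ring
  have heq : ∀ q' ∈ Ioi (0 : ℝ), ∫ p' : ℝ,
        p' ^ 2 * ‖hinner (Uop q p (fun x => (ψ x : ℂ)))
          (Uop q' p' (fun x => (ψ x : ℂ)))‖ ^ 2 =
      2 * Real.pi * ∫ x in Ioi 0, g.overlapDensity p q q' x := fun q' hq' => by
    simp only [hinner_Uop_eq hg hq hq']
    rw [((g.dilateMul hq hq').integral_sq_mul_norm_fourier_sq p).2,
      g.integral_deriv_dilateMul_sq hg0 hq hq' p]
  refine ⟨fun q' hq' => ?_, ?_, ?_⟩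
  · simp only [hinner_Uop_eq hg hq hq']
    exact ((g.dilateMul hq hq').integral_sq_mul_norm_fourier_sq p).1
  · exact IntegrableOn.congr_fun (hJi.const_mul (2 * Real.pi)) (fun q' hq' => (heq q' hq').symm)
      measurableSet_Ioi
  · rw [setIntegral_congr_fun measurableSet_Ioi heq, integral_const_mul, hJ, hval, hc1, hc0, hgn]
    have hpi := Real.pi_ne_zero
    generalize (∫ x in Ioi 0, g x ^ 2 * x ^ (-1 : ℤ)) = c₁ at hc1ne ⊢
    generalize (∫ x in Ioi 0, g x ^ 2 * x ^ (-2 : ℤ)) = c₀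
    generalize (∫ x in Ioi 0, deriv g x ^ 2 * x) = d₁
    generalize (∫ x in Ioi 0, deriv g x ^ 2) = d₀
    field_simp
    ring
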